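/- Let n ≥ 1 be an odd integer and let 0 < s ≤ π. If μ is a finitely supported probability measure on S^1 = ℝ/2πℤ whose support has diameter at most π − s in the geodesic metric, then the support of g_n(μ) has diameter at most π − s/n. Consequently, g_n maps VR^m(S^1; π−s) into VR^m(S^1; π−s/n). -/

import Mathlib

open MeasureTheory Metric Set
open scoped NNReal ENNReal

noncomputable section

/-- The circle `S¹ = ℝ/2πℤ`, with the quotient (geodesic) metric. -/
abbrev Circ : Type := AddCircle (2 * Real.pi)

instance : Fact (0 < 2 * Real.pi) := ⟨by positivity⟩

/-- The support of a finitely-supported measure: the set of atoms. -/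
def mSupport {X : Type*} [MeasurableSpace X] (μ : ProbabilityMeasure X) : Set X :=
  {x | μ.toMeasure {x} ≠ 0}

/-- A probability measure is finitely supported if some finite set has full measure. -/
def FinSupp {X : Type*} [MeasurableSpace X] (μ : ProbabilityMeasure X) : Prop :=
  ∃ S : Finset X, μ.toMeasure ↑S = 1

/-- The Vietoris--Rips metric thickening `VR^m(X; r)`: the set of finitely supported
probability measures on `X` whose support has diameter at most `r`, topologized as a subspace
of the probability measures on `X` with the topology of weak convergence. -/
def VRm (X : Type*) [MetricSpace X] [MeasurableSpace X] (r : ℝ) :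
    Set (ProbabilityMeasure X) :=
  {μ | FinSupp μ ∧ Metric.diam (mSupport μ) ≤ r}

/-- The representative in `[0, 2π)` of a point of the circle `ℝ/2πℤ`. -/
def rep (x : Circ) : ℝ := (AddCircle.equivIco (2 * Real.pi) 0 x : ℝ)

/-- The `t`-th branch `x ↦ x/n + 2πt/n` of the inverse of the `n`-fold cover of the circle,
using the representative of `x` in `[0, 2π)`. -/
def divMap (n : ℕ) (t : ℕ) (x : Circ) : Circ :=
  ((rep x / n + 2 * Real.pi * t / n : ℝ) : Circ)

lemma measurable_rep : Measurable rep := by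
  have : rep = fun x => ((AddCircle.measurableEquivIco (2 * Real.pi) 0 x : ℝ)) := rfl
  rw [this]
  exact measurable_subtype_coe.comp (AddCircle.measurableEquivIco (2 * Real.pi) 0).measurable

lemma measurable_divMap (n t : ℕ) : Measurable (divMap n t) := by
  apply Measurable.comp (f := fun x => (rep x / n + 2 * Real.pi * t / n : ℝ))
    (g := fun y : ℝ => (y : Circ))
  · exact AddCircle.measurable_mk'
  · exact (measurable_rep.div_const _).add_const _

/-- The measure `g_n(μ) = Σ_{t<n} (1/n) (divMap n t)_* μ`.  For `μ = Σ_j a_j δ_{θ_j}` with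
`θ_j ∈ [0, 2π)` this is `Σ_{t<n} Σ_j (a_j/n) δ_{θ_j/n + 2πt/n}`. -/
def gm (n : ℕ) (μ : ProbabilityMeasure Circ) : Measure Circ :=
  ∑ t : Fin n, (n : ℝ≥0∞)⁻¹ • (μ.toMeasure.map (divMap n t))

lemma isProbabilityMeasure_gm (n : ℕ) (hn : n ≠ 0) (μ : ProbabilityMeasure Circ) :
    IsProbabilityMeasure (gm n μ) := by
  constructor
  rw [gm, Measure.finset_sum_apply]
  have : ∀ t : Fin n, ((n : ℝ≥0∞)⁻¹ • (μ.toMeasure.map (divMap n (t : ℕ)))) univ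
      = (n : ℝ≥0∞)⁻¹ := by
    intro t
    rw [Measure.smul_apply, Measure.map_apply (measurable_divMap n t) MeasurableSet.univ]
    simp
  rw [Finset.sum_congr rfl fun t _ => this t]
  rw [Finset.sum_const, Finset.card_univ, Fintype.card_fin, nsmul_eq_mul]
  exact ENNReal.mul_inv_cancel (by exact_mod_cast hn) (by simp)

/-- The map `g_n` on probability measures on the circle. -/
def gPM (n : ℕ) (hn : n ≠ 0) (μ : ProbabilityMeasure Circ) : ProbabilityMeasure Circ :=
  ⟨gm n μ, isProbabilityMeasure_gm n hn μ⟩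

lemma Circ.norm_coe_le (r : ℝ) : ‖(r : Circ)‖ ≤ |r| := by
  exact QuotientAddGroup.norm_mk_le_norm

lemma Circ.norm_pi : ‖((Real.pi : ℝ) : Circ)‖ = Real.pi := by
  have h := AddCircle.norm_half_period_eq (2 * Real.pi)
  have e : 2 * Real.pi / 2 = Real.pi := by ring
  rw [e, abs_of_pos (by positivity), e] at h
  exact h

lemma Circ.norm_add_le (z : Circ) : ‖z‖ + ‖z - ((Real.pi : ℝ) : Circ)‖ ≤ Real.pi := by
  obtain ⟨h0, h2⟩ := (AddCircle.equivIco (2 * Real.pi) 0 z).2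
  have hz : ((AddCircle.equivIco (2 * Real.pi) 0 z : ℝ) : Circ) = z :=
    (AddCircle.equivIco (2 * Real.pi) 0).symm_apply_apply z
  generalize (AddCircle.equivIco (2 * Real.pi) 0 z : ℝ) = r at *
  subst hz
  have h3 := Circ.norm_coe_le (r - Real.pi)
  rw [AddCircle.coe_sub] at h3
  rcases le_total r Real.pi with h | h
  · have h1 := Circ.norm_coe_le r
    rw [abs_of_nonneg h0] at h1
    rw [abs_of_nonpos (by linarith)] at h3
    linarith
  · have h1 := Circ.norm_coe_le (r - 2 * Real.pi)
    rw [AddCircle.coe_sub, AddCircle.coe_period, sub_zero, abs_of_nonpos (by linarith)] at h1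
    rw [abs_of_nonneg (by linarith)] at h3
    linarith

lemma Circ.nsmul_pi (n : ℕ) (hodd : Odd n) :
    n • ((Real.pi : ℝ) : Circ) = ((Real.pi : ℝ) : Circ) := by
  obtain ⟨k, rfl⟩ := hodd
  have : (2 : ℕ) • ((Real.pi : ℝ) : Circ) = 0 := by
    rw [← AddCircle.coe_nsmul, nsmul_eq_mul]
    exact AddCircle.coe_period _
  rw [add_nsmul, mul_comm, mul_nsmul, mul_comm] <;> simp [this]

lemma Circ.key (n : ℕ) (hodd : Odd n) (hn : 1 ≤ n) (s : ℝ) (z : Circ)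
    (h : ‖n • z‖ ≤ Real.pi - s) : ‖z‖ ≤ Real.pi - s / n := by
  have hn0 : (0 : ℝ) < n := by exact_mod_cast hn
  have h1 := Circ.norm_add_le z
  have h2 : ‖n • (z - ((Real.pi : ℝ) : Circ))‖ ≤ n * ‖z - ((Real.pi : ℝ) : Circ)‖ :=
    norm_nsmul_le
  rw [nsmul_sub, Circ.nsmul_pi n hodd] at h2
  have h3 := norm_sub_norm_le ((Real.pi : ℝ) : Circ) (n • z)
  rw [Circ.norm_pi, norm_sub_rev] at h3
  have h4 : s ≤ n * (Real.pi - ‖z‖) := by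
    calc s ≤ n * ‖z - ((Real.pi : ℝ) : Circ)‖ := by linarith
      _ ≤ _ := by gcongr; linarith
  have : s / n ≤ Real.pi - ‖z‖ := by rw [div_le_iff₀ hn0]; linarith
  linarith

lemma nsmul_divMap (n : ℕ) (hn : 1 ≤ n) (t : ℕ) (x : Circ) : n • divMap n t x = x := by
  have hn0 : (n : ℝ) ≠ 0 := by positivity
  have hz : ((rep x : ℝ) : Circ) = x :=
    (AddCircle.equivIco (2 * Real.pi) 0).symm_apply_apply x
  have e : n • (rep x / n + 2 * Real.pi * t / n : ℝ) = rep x + t • (2 * Real.pi) := by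
    simp only [nsmul_eq_mul]; field_simp
  rw [divMap, ← AddCircle.coe_nsmul, e, AddCircle.coe_add, AddCircle.coe_nsmul,
    AddCircle.coe_period, smul_zero, add_zero, hz]

lemma mem_of_mem_support (n : ℕ) (hn : 1 ≤ n) (hn' : n ≠ 0) (μ : ProbabilityMeasure Circ)
    (y : Circ) (hy : y ∈ mSupport (gPM n hn' μ)) : n • y ∈ mSupport μ := by
  intro h
  apply hy
  change gm n μ {y} = 0
  rw [gm, Measure.finset_sum_apply]
  apply Finset.sum_eq_zero
  intro t _
  rw [Measure.smul_apply, Measure.map_apply (measurable_divMap n t) (measurableSet_singleton y)]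
  have : μ.toMeasure (divMap n t ⁻¹' {y}) = 0 := by
    apply measure_mono_null _ h
    intro x hx
    have hx : divMap n t x = y := hx
    rw [← hx, nsmul_divMap n hn]
    rfl
  rw [this]; simp

lemma diam_gPM (n : ℕ) (hodd : Odd n) (hn : 1 ≤ n) (hn' : n ≠ 0) (s : ℝ)
    (hsπ : s ≤ Real.pi) (μ : ProbabilityMeasure Circ)
    (hdiam : Metric.diam (mSupport μ) ≤ Real.pi - s) :
    Metric.diam (mSupport (gPM n hn' μ)) ≤ Real.pi - s / n := by
  have hn1 : (1 : ℝ) ≤ n := by exact_mod_cast hn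
  apply Metric.diam_le_of_forall_dist_le
  · have : s / n ≤ Real.pi := by
      rw [div_le_iff₀ (by linarith)]
      nlinarith [Real.pi_pos]
    linarith
  intro y hy y' hy'
  rw [dist_eq_norm]
  apply Circ.key n hodd hn
  rw [nsmul_sub, ← dist_eq_norm]
  exact (Metric.dist_le_diam_of_mem (isCompact_univ.isBounded.subset (subset_univ _))
    (mem_of_mem_support n hn hn' μ y hy) (mem_of_mem_support n hn hn' μ y' hy')).trans hdiam

lemma finSupp_gPM (n : ℕ) (hn' : n ≠ 0) (μ : ProbabilityMeasure Circ) (h : FinSupp μ) :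
    FinSupp (gPM n hn' μ) := by
  classical
  obtain ⟨S, hS⟩ := h
  refine ⟨Finset.univ.biUnion fun t : Fin n => S.image (divMap n t), ?_⟩
  set T := Finset.univ.biUnion fun t : Fin n => S.image (divMap n t) with hT
  change gm n μ ↑T = 1
  rw [gm, Measure.finset_sum_apply]
  have : ∀ t : Fin n, ((n : ℝ≥0∞)⁻¹ • (μ.toMeasure.map (divMap n (t : ℕ)))) ↑T
      = (n : ℝ≥0∞)⁻¹ := by
    intro t
    rw [Measure.smul_apply, Measure.map_apply (measurable_divMap n t) T.measurableSet]
    have : μ.toMeasure (divMap n t ⁻¹' ↑T) = 1 := by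
      apply le_antisymm prob_le_one
      rw [← hS]
      apply measure_mono
      intro x hx
      simp only [hT, mem_preimage, Finset.mem_coe, Finset.mem_biUnion, Finset.mem_image]
      exact ⟨t, Finset.mem_univ _, x, hx, rfl⟩
    rw [this]; simp
  rw [Finset.sum_congr rfl fun t _ => this t]
  rw [Finset.sum_const, Finset.card_univ, Fintype.card_fin, nsmul_eq_mul]
  exact ENNReal.mul_inv_cancel (by exact_mod_cast hn') (by simp)

theorem gmap_diam_support (n : ℕ) (hodd : Odd n) (hn : 1 ≤ n) (s : ℝ)
    (hs0 : 0 < s) (hsπ : s ≤ Real.pi) (μ : ProbabilityMeasure Circ) (hfin : FinSupp μ)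
    (hdiam : Metric.diam (mSupport μ) ≤ Real.pi - s) :
    Metric.diam (mSupport (gPM n (Nat.one_le_iff_ne_zero.mp hn) μ)) ≤ Real.pi - s / n ∧
    (∀ ν ∈ VRm Circ (Real.pi - s),
      gPM n (Nat.one_le_iff_ne_zero.mp hn) ν ∈ VRm Circ (Real.pi - s / n)) :=
  ⟨diam_gPM n hodd hn _ s hsπ μ hdiam, fun ν hν =>
    ⟨finSupp_gPM n _ ν hν.1, diam_gPM n hodd hn _ s hsπ ν hν.2⟩⟩
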